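/- Let F be a bent vectorial function from GF(2^{2m}) to GF(2^ℓ) with m ≥ 3, and let C(F) = {(Tr_{2^ℓ/2}(a F(x)) + Tr_{2^{2m}/2}(b x) + c)_{x ∈ GF(2^{2m})} : a ∈ GF(2^ℓ), b ∈ GF(2^{2m}), c ∈ GF(2)}, a [2^{2m}, 2m+ℓ+1] code with weight distribution: weight 2^{2m-1} - 2^{m-1} with multiplicity (2^ℓ - 1)2^{2m}, weight 2^{2m-1} with multiplicity 2(2^{2m} - 1), weight 2^{2m-1} + 2^{m-1} with multiplicity (2^ℓ - 1)2^{2m}, weight 2^{2m} with multiplicity 1, and which supports 2-designs. Then for any coordinate position t1, the shortened code C(F)_{t1} has length 2^{2m} - 1, dimension 2m + ℓ, and nonzero weights 2^{2m-1} - 2^{m-1}, 2^{2m-1}, 2^{2m-1} + 2^{m-1}, with multiplicities (2^ℓ - 1)(2^{2m-1} + 2^{m-1}), 2^{2m} - 1, (2^ℓ - 1)(2^{2m-1} - 2^{m-1}) respectively. -/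

import Mathlib

open Finset

variable {F : Type*} [Field F] {ι : Type*} [Fintype ι]

/-- Hamming weight of a vector. -/
noncomputable def wt (c : ι → F) : ℕ := Nat.card {i : ι // c i ≠ 0}

/-- Number of codewords of weight `k` in a linear code `C`. -/
noncomputable def Acount (C : Submodule F (ι → F)) (k : ℕ) : ℕ :=
  Nat.card {c : C // wt (c : ι → F) = k}

/-- `d` is the minimum (Hamming) distance of the code `C`. -/
def IsMinDist (C : Submodule F (ι → F)) (d : ℕ) : Prop :=
  (∃ c ∈ C, c ≠ 0 ∧ wt c = d) ∧ ∀ c ∈ C, c ≠ 0 → d ≤ wt c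

/-- The dual code with respect to the standard inner product. -/
def dualCode (C : Submodule F (ι → F)) : Submodule F (ι → F) where
  carrier := {x | ∀ c ∈ C, ∑ i, x i * c i = 0}
  add_mem' := by
    intro x y hx hy c hc
    simp only [Set.mem_setOf_eq] at *
    simp [Pi.add_apply, add_mul, Finset.sum_add_distrib, hx c hc, hy c hc]
  zero_mem' := by simp
  smul_mem' := by
    intro a x hx c hc
    simp only [Set.mem_setOf_eq] at *
    simp [Pi.smul_apply, smul_eq_mul, mul_assoc, ← Finset.mul_sum, hx c hc]

/-- The submodule of vectors vanishing on `T`. -/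
def vanishOn (T : Finset ι) : Submodule F (ι → F) where
  carrier := {x | ∀ i ∈ T, x i = 0}
  add_mem' := by
    intro x y hx hy i hi
    simp [hx i hi, hy i hi]
  zero_mem' := by intro i _; rfl
  smul_mem' := by
    intro a x hx i hi
    simp [hx i hi]

/-- The punctured code: delete the coordinates in `T`. -/
def punctured (C : Submodule F (ι → F)) (T : Finset ι) :
    Submodule F ({i : ι // i ∉ T} → F) :=
  C.map (LinearMap.funLeft F F (Subtype.val : {i : ι // i ∉ T} → ι))

/-- The shortened code: codewords vanishing on `T`, with the coordinates in `T` deleted. -/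
def shortened (C : Submodule F (ι → F)) (T : Finset ι) :
    Submodule F ({i : ι // i ∉ T} → F) :=
  punctured (C ⊓ vanishOn T) T

/-- The supports of the weight-`k` codewords of `C` (with multiplicities divided by `q-1`)
form a `t`-design: every `t`-set of coordinates lies in the same number of supports. -/
def SupportsDesign [Fintype F] (t : ℕ) (C : Submodule F (ι → F)) (k : ℕ) : Prop :=
  ∃ lam : ℕ, ∀ T : Finset ι, T.card = t →
    Nat.card {c : C // wt (c : ι → F) = k ∧ ∀ i ∈ T, (c : ι → F) i ≠ 0} =
      (Fintype.card F - 1) * lam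

/-- `(P, B)` is a `t`-`(v, k, lam)` design (with `v = Fintype.card P`). -/
def IsBlockDesign (t k lam : ℕ) {P : Type*} [Fintype P] [DecidableEq P]
    (B : Multiset (Finset P)) : Prop :=
  (∀ b ∈ B, b.card = k) ∧
  ∀ T : Finset P, T.card = t → B.countP (fun b => T ⊆ b) = lam

/-- The additive character `(-1)^y` of `ZMod 2` with values in `ℤ`. -/
def chi : ZMod 2 → ℤ := fun y => if y = 0 then 1 else -1

theorem chi_add' (a b : ZMod 2) : chi (a + b) = chi a * chi b := by
  revert a b; unfold chi; decide

theorem two_wt {κ : Type*} [Fintype κ] (h : κ → ZMod 2) :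
    2 * (wt h : ℤ) = Fintype.card κ - ∑ x, chi (h x) := by
  classical
  have h1 : ∀ x, chi (h x) = 1 - 2 * (if h x ≠ 0 then 1 else 0) := by
    intro x
    unfold chi
    by_cases hx : h x = 0 <;> simp [hx]
  simp only [h1, Finset.sum_sub_distrib, ← Finset.mul_sum]
  rw [wt, Nat.card_eq_fintype_card, Fintype.card_subtype, Finset.sum_boole]
  simp

theorem sum_chi_trace {K : Type*} [Field K] [Fintype K] [Algebra (ZMod 2) K] (b : K) (hb : b ≠ 0) :
    ∑ x : K, chi (Algebra.trace (ZMod 2) K (b * x)) = 0 := by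
  obtain ⟨z, hz⟩ := Algebra.trace_surjective (ZMod 2) K 1
  have h : ∑ x : K, chi (Algebra.trace (ZMod 2) K (b * x)) =
      ∑ x : K, chi (Algebra.trace (ZMod 2) K (b * (x + b⁻¹ * z))) :=
    (Fintype.sum_equiv (Equiv.addRight (b⁻¹ * z)) _ _ (fun x => rfl)).symm
  have h2 : ∀ x : K, chi (Algebra.trace (ZMod 2) K (b * (x + b⁻¹ * z))) =
      - chi (Algebra.trace (ZMod 2) K (b * x)) := by
    intro x
    rw [mul_add, mul_inv_cancel_left₀ hb, map_add, hz, chi_add']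
    simp [chi]
  simp only [h2, Finset.sum_neg_distrib] at h
  linarith

/-- Codeword parametrization. -/
noncomputable def cwMap {K : Type*} [Field K] [Algebra (ZMod 2) K]
    {L : Type*} [Field L] [Algebra (ZMod 2) L] (Fv : K → L) :
    (L × K × ZMod 2) →ₗ[ZMod 2] (K → ZMod 2) where
  toFun p := fun x => Algebra.trace (ZMod 2) L (p.1 * Fv x) +
        Algebra.trace (ZMod 2) K (p.2.1 * x) + p.2.2
  map_add' p q := by
    funext x
    simp only [Prod.fst_add, Prod.snd_add, add_mul, map_add, Pi.add_apply]
    ring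
  map_smul' r p := by
    funext x
    simp only [Prod.smul_fst, Prod.smul_snd, smul_mul_assoc, map_smul, Pi.smul_apply,
      RingHom.id_apply, smul_add]

/-- Codewords vanishing at `t`. -/
noncomputable def shMap {K : Type*} [Field K] [Algebra (ZMod 2) K]
    {L : Type*} [Field L] [Algebra (ZMod 2) L] (Fv : K → L) (t : K) :
    (L × K) →ₗ[ZMod 2] (K → ZMod 2) where
  toFun p := fun x => (Algebra.trace (ZMod 2) L (p.1 * Fv x) +
        Algebra.trace (ZMod 2) K (p.2 * x)) + (Algebra.trace (ZMod 2) L (p.1 * Fv t) +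
        Algebra.trace (ZMod 2) K (p.2 * t))
  map_add' p q := by
    funext x
    simp only [Prod.fst_add, Prod.snd_add, add_mul, map_add, Pi.add_apply]
    ring
  map_smul' r p := by
    funext x
    simp only [Prod.smul_fst, Prod.smul_snd, smul_mul_assoc, map_smul, Pi.smul_apply,
      RingHom.id_apply, smul_add]

theorem zadd (a : ZMod 2) : a + a = 0 := by revert a; decide

theorem shortened_eq {K : Type*} [Field K] [Fintype K] [Algebra (ZMod 2) K]
    {L : Type*} [Field L] [Algebra (ZMod 2) L] (Fv : K → L) (t : K) :
    shortened (LinearMap.range (cwMap Fv)) {t} =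
      LinearMap.range ((LinearMap.funLeft (ZMod 2) (ZMod 2)
        (Subtype.val : {i : K // i ∉ ({t} : Finset K)} → K)).comp (shMap Fv t)) := by
  ext y
  simp only [shortened, punctured, Submodule.mem_map, Submodule.mem_inf, LinearMap.mem_range]
  constructor
  · rintro ⟨c, ⟨⟨p, rfl⟩, hc⟩, rfl⟩
    refine ⟨(p.1, p.2.1), ?_⟩
    have h0 : cwMap Fv p t = 0 := hc t (by simp)
    rw [LinearMap.comp_apply]
    congr 1
    funext x
    simp only [cwMap, shMap, LinearMap.coe_mk, AddHom.coe_mk] at h0 ⊢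
    have := zadd p.2.2
    congr 1
    linear_combination h0 - this
  · rintro ⟨p, rfl⟩
    refine ⟨shMap Fv t p, ⟨⟨(p.1, p.2, _), rfl⟩, ?_⟩, rfl⟩
    intro i hi
    rw [Finset.mem_singleton] at hi
    subst hi
    exact zadd _

theorem wt_restrict {K : Type*} [Fintype K] (t : K) (c : K → ZMod 2) (hc : c t = 0) :
    wt (fun i : {i : K // i ∉ ({t} : Finset K)} => c i) = wt c := by
  unfold wt
  refine Nat.card_congr ⟨fun i => ⟨i.1.1, i.2⟩, fun i => ⟨⟨i.1, ?_⟩, i.2⟩,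
    fun _ => rfl, fun _ => rfl⟩
  intro h
  rw [Finset.mem_singleton] at h
  exact i.2 (h ▸ hc)

theorem Acount_range {A : Type*} [AddCommGroup A] [Module (ZMod 2) A] {κ : Type*} [Fintype κ]
    (φ : A →ₗ[ZMod 2] (κ → ZMod 2)) (hφ : Function.Injective φ) (k : ℕ) :
    Acount (LinearMap.range φ) k = Nat.card {p : A // wt (φ p) = k} := by
  unfold Acount
  exact (Nat.card_congr ((LinearEquiv.ofInjective φ hφ).toEquiv.subtypeEquiv
    (fun a => Iff.rfl))).symm

/-- The abstract counting argument. -/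
theorem count_lemma {L K : Type*} [Fintype L] [Fintype K] [Zero L] [Zero K]
    (M : ℕ) (hM : 2 ≤ M) (V : L × K → ℤ) (hK : Fintype.card K = 4 * M ^ 2)
    (h00 : V (0, 0) = 4 * M ^ 2) (h0 : ∀ b, b ≠ 0 → V (0, b) = 0)
    (h1 : ∀ a, a ≠ 0 → ∀ b, V (a, b) = 2 * M ∨ V (a, b) = -(2 * M))
    (hs : ∀ a, a ≠ 0 → ∑ b, V (a, b) = 4 * M ^ 2) :
    Nat.card {p // V p = 2 * M} = (Fintype.card L - 1) * (2 * M ^ 2 + M) ∧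
    Nat.card {p // V p = 0} = 4 * M ^ 2 - 1 ∧
    Nat.card {p // V p = -(2 * M)} = (Fintype.card L - 1) * (2 * M ^ 2 - M) := by
  classical
  have hM' : (2 : ℤ) ≤ M := by exact_mod_cast hM
  have key : ∀ a, a ≠ 0 → (univ.filter fun b => V (a, b) = 2 * M).card = 2 * M ^ 2 + M ∧
      (univ.filter fun b => V (a, b) = -(2 * M)).card = 2 * M ^ 2 - M := by
    intro a ha
    have e1 : (univ.filter fun b => V (a, b) = -(2 * M)) =
        univ.filter fun b => ¬ V (a, b) = 2 * M := by
      apply Finset.filter_congr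
      intro b _
      rcases h1 a ha b with h | h <;> rw [h] <;> constructor <;> intros <;> omega
    have e2 := Finset.card_filter_add_card_filter_not (s := (univ : Finset K))
      (fun b => V (a, b) = 2 * M)
    rw [Finset.card_univ, hK] at e2
    rw [e1]
    have e3 : ∀ b, V (a, b) = 2 * M * (2 * (if V (a, b) = 2 * M then 1 else 0) - 1) := by
      intro b
      rcases h1 a ha b with h | h
      · rw [if_pos h, h]; ring
      · rw [if_neg (by omega), h]; ring
    have e4 := hs a ha
    rw [Finset.sum_congr rfl (fun b _ => e3 b), ← Finset.mul_sum, Finset.sum_sub_distrib,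
      ← Finset.mul_sum, Finset.sum_boole] at e4
    simp only [Finset.sum_const, Finset.card_univ, hK, nsmul_eq_mul, mul_one] at e4
    push_cast at e4
    generalize (univ.filter fun b => V (a, b) = 2 * M).card = N at *
    have e5 : (N : ℤ) = 2 * M ^ 2 + M := by
      have : (2 * M : ℤ) * (2 * N - 4 * M ^ 2 - 2 * M) = 0 := by linear_combination e4
      rcases mul_eq_zero.1 this with h | h
      · omega
      · linarith
    have e6 : N = 2 * M ^ 2 + M := by exact_mod_cast e5
    exact ⟨e6, by omega⟩
  have tot : ∀ v : ℤ, Nat.card {p // V p = v} =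
      ∑ a, (univ.filter fun b => V (a, b) = v).card := by
    intro v
    rw [Nat.card_eq_fintype_card, Fintype.card_subtype]
    simp only [Finset.card_filter]
    rw [Fintype.sum_prod_type]
  have hsplit : ∀ f : L → ℕ, ∀ c, (∀ a, a ≠ 0 → f a = c) →
      ∑ a, f a = f 0 + (Fintype.card L - 1) * c := by
    intro f c h
    rw [← Finset.add_sum_erase univ f (mem_univ 0),
      Finset.sum_congr rfl (fun a ha => h a (Finset.ne_of_mem_erase ha))]
    simp [Finset.card_erase_of_mem]
  have hV0 : ∀ b, V (0, b) = 4 * M ^ 2 ∨ V (0, b) = 0 := by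
    intro b
    by_cases hb : b = 0
    · left; rw [hb, h00]
    · right; exact h0 b hb
  refine ⟨?_, ?_, ?_⟩
  · rw [tot, hsplit _ _ (fun a ha => (key a ha).1), Finset.filter_false_of_mem]
    · simp
    · intro b _ h
      rcases hV0 b with h' | h' <;> nlinarith
  · rw [tot, hsplit _ 0]
    · have : (univ.filter fun b => V (0, b) = 0) = univ.erase 0 := by
        ext b
        simp only [mem_filter, mem_univ, true_and, mem_erase, and_true]
        constructor
        · rintro h rfl
          nlinarith
        · exact h0 b
      rw [this, Finset.card_erase_of_mem (mem_univ _), Finset.card_univ, hK]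
      simp
    · intro a ha
      rw [Finset.card_eq_zero, Finset.filter_false_of_mem]
      intro b _ h
      rcases h1 a ha b with h' | h' <;> omega
  · rw [tot, hsplit _ _ (fun a ha => (key a ha).2), Finset.filter_false_of_mem]
    · simp
    · intro b _ h
      rcases hV0 b with h' | h' <;> nlinarith

set_option maxHeartbeats 1000000 in
/-- shortening the code `C(F)` of a bent vectorial function
`F : GF(2^{2m}) → GF(2^ℓ)` (`m ≥ 3`) at one coordinate gives a three-weight
`[2^{2m} - 1, 2m + ℓ]` binary code with the stated weight distribution. -/
theorem shortened_vectorial_bent_code (m l : ℕ) (hm : 3 ≤ m)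
    (K : Type*) [Field K] [Fintype K] [Algebra (ZMod 2) K]
    (hK : Fintype.card K = 2 ^ (2 * m))
    (L : Type*) [Field L] [Fintype L] [Algebra (ZMod 2) L]
    (hL : Fintype.card L = 2 ^ l)
    (Fv : K → L)
    (hbent : ∀ a : L, a ≠ 0 → ∀ b : K,
      (∑ x : K, chi (Algebra.trace (ZMod 2) L (a * Fv x) +
        Algebra.trace (ZMod 2) K (b * x))) = 2 ^ m ∨
      (∑ x : K, chi (Algebra.trace (ZMod 2) L (a * Fv x) +
        Algebra.trace (ZMod 2) K (b * x))) = -(2 ^ m))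
    (CF : Submodule (ZMod 2) (K → ZMod 2))
    (hCF : CF = Submodule.span (ZMod 2) (Set.range fun p : L × K × ZMod 2 =>
      fun x : K => Algebra.trace (ZMod 2) L (p.1 * Fv x) +
        Algebra.trace (ZMod 2) K (p.2.1 * x) + p.2.2))
    (t1 : K) :
    Nat.card {i : K // i ∉ ({t1} : Finset K)} = 2 ^ (2 * m) - 1 ∧
    Module.finrank (ZMod 2) (shortened CF {t1}) = 2 * m + l ∧
    Acount (shortened CF {t1}) (2 ^ (2 * m - 1) - 2 ^ (m - 1)) =
      (2 ^ l - 1) * (2 ^ (2 * m - 1) + 2 ^ (m - 1)) ∧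
    Acount (shortened CF {t1}) (2 ^ (2 * m - 1)) = 2 ^ (2 * m) - 1 ∧
    Acount (shortened CF {t1}) (2 ^ (2 * m - 1) + 2 ^ (m - 1)) =
      (2 ^ l - 1) * (2 ^ (2 * m - 1) - 2 ^ (m - 1)) ∧
    ∀ k : ℕ, k ≠ 0 → k ≠ 2 ^ (2 * m - 1) - 2 ^ (m - 1) → k ≠ 2 ^ (2 * m - 1) →
      k ≠ 2 ^ (2 * m - 1) + 2 ^ (m - 1) → Acount (shortened CF {t1}) k = 0 := by
  classical
  have hCF' : CF = LinearMap.range (cwMap Fv) := by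
    rw [hCF]
    exact (Submodule.span_eq (LinearMap.range (cwMap Fv)))
  obtain ⟨n, rfl⟩ : ∃ n, m = n + 1 := ⟨m - 1, by omega⟩
  have p1 : 2 ^ (n + 1 - 1) = 2 ^ n := rfl
  have p2 : 2 ^ (2 * (n + 1) - 1) = 2 * (2 ^ n) ^ 2 := by
    rw [show 2 * (n + 1) - 1 = n * 2 + 1 by omega, pow_succ, pow_mul]; ring
  have p3 : 2 ^ (2 * (n + 1)) = 4 * (2 ^ n) ^ 2 := by ring
  have p4 : (2 : ℤ) ^ (n + 1) = 2 * ((2 ^ n : ℕ) : ℤ) := by push_cast; ring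
  have hM : 2 ≤ 2 ^ n := by
    calc 2 = 2 ^ 1 := rfl
      _ ≤ 2 ^ n := Nat.pow_le_pow_right (by norm_num) (by omega)
  have hfK : Module.finrank (ZMod 2) K = 2 * (n + 1) := by
    have := Module.card_eq_pow_finrank (K := ZMod 2) (V := K)
    rw [hK, ZMod.card] at this
    exact (Nat.pow_right_injective le_rfl this).symm
  have hfL : Module.finrank (ZMod 2) L = l := by
    have := Module.card_eq_pow_finrank (K := ZMod 2) (V := L)
    rw [hL, ZMod.card] at this
    exact (Nat.pow_right_injective le_rfl this).symm
  rw [p2, p1, p3, ← hL]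
  rw [p3] at hK
  simp only [p4] at hbent
  generalize 2 ^ n = M at *
  have hM' : (2 : ℤ) ≤ M := by exact_mod_cast hM
  have hMM : (2 : ℤ) * M ≤ M ^ 2 := by nlinarith
  let V : L × K → ℤ := fun p => ∑ x, chi (shMap Fv t1 p x)
  have hVe : ∀ a b, V (a, b) = (∑ x : K, chi (Algebra.trace (ZMod 2) L (a * Fv x) +
        Algebra.trace (ZMod 2) K (b * x))) * chi (Algebra.trace (ZMod 2) L (a * Fv t1) +
        Algebra.trace (ZMod 2) K (b * t1)) := by
    intro a b
    simp only [V, shMap, LinearMap.coe_mk, AddHom.coe_mk]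
    rw [Finset.sum_mul]
    exact Finset.sum_congr rfl (fun x _ => chi_add' _ _)
  have hchi : ∀ y, chi y = 1 ∨ chi y = -1 := by unfold chi; decide
  have h00 : V (0, 0) = 4 * M ^ 2 := by
    rw [hVe]
    simp [chi, hK]
  have h0 : ∀ b, b ≠ 0 → V (0, b) = 0 := by
    intro b hb
    rw [hVe]
    simp [sum_chi_trace b hb]
  have h1 : ∀ a, a ≠ 0 → ∀ b, V (a, b) = 2 * M ∨ V (a, b) = -(2 * M) := by
    intro a ha b
    rw [hVe]
    rcases hbent a ha b with h | h <;>
      rcases hchi (Algebra.trace (ZMod 2) L (a * Fv t1) +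
        Algebra.trace (ZMod 2) K (b * t1)) with h' | h' <;> rw [h, h'] <;> simp
  have hs : ∀ a, a ≠ 0 → ∑ b, V (a, b) = 4 * M ^ 2 := by
    intro a _
    simp only [V]
    rw [Finset.sum_comm, Finset.sum_eq_single t1]
    · have : ∀ b, shMap Fv t1 (a, b) t1 = 0 := fun b => zadd _
      simp [this, chi, hK]
    · intro x _ hx
      have : ∀ b, chi (shMap Fv t1 (a, b) x) = chi (Algebra.trace (ZMod 2) L (a * Fv x) +
          Algebra.trace (ZMod 2) L (a * Fv t1)) *
          chi (Algebra.trace (ZMod 2) K ((x + t1) * b)) := by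
        intro b
        rw [← chi_add']
        simp only [shMap, LinearMap.coe_mk, AddHom.coe_mk]
        rw [add_mul, map_add, mul_comm x b, mul_comm t1 b]
        congr 1
        ring
      simp only [this]
      rw [← Finset.mul_sum, sum_chi_trace, mul_zero]
      intro h
      apply hx
      have h2 : t1 + t1 = 0 := by
        have : ((1 : ZMod 2) + 1) • t1 = 0 := by rw [zadd, zero_smul]
        rwa [add_smul, one_smul] at this
      exact add_right_cancel (h.trans h2.symm)
    · simp
  obtain ⟨c1, c2, c3⟩ := count_lemma M hM V hK h00 h0 h1 hs
  let φ := (LinearMap.funLeft (ZMod 2) (ZMod 2)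
        (Subtype.val : {i : K // i ∉ ({t1} : Finset K)} → K)).comp (shMap Fv t1)
  have hwt : ∀ p, 2 * (wt (φ p) : ℤ) = 4 * M ^ 2 - V p := by
    intro p
    have e : wt (φ p) = wt (shMap Fv t1 p) := wt_restrict t1 (shMap Fv t1 p) (zadd _)
    rw [e, two_wt, hK]
    push_cast
    rfl
  have hVall : ∀ p, p ≠ 0 → V p = 0 ∨ V p = 2 * M ∨ V p = -(2 * M) := by
    rintro ⟨a, b⟩ hp
    by_cases ha : a = 0
    · subst ha
      left
      apply h0
      rintro rfl
      exact hp rfl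
    · right
      exact h1 a ha b
  have hinj : Function.Injective φ := by
    rw [← LinearMap.ker_eq_bot, LinearMap.ker_eq_bot']
    intro p hp
    by_contra hne
    have e := hwt p
    have e0 : wt (φ p) = 0 := by
      rw [hp]; simp [wt]
    rw [e0] at e
    push_cast at e
    rcases hVall p hne with h | h | h <;> rw [h] at e <;> linarith
  have hsh : shortened CF {t1} = LinearMap.range φ := by
    rw [hCF']
    exact shortened_eq Fv t1
  have hle : M ≤ 2 * M ^ 2 := by nlinarith
  have hA : ∀ k : ℕ, ∀ v : ℤ, 2 * (k : ℤ) = 4 * M ^ 2 - v →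
      Acount (LinearMap.range φ) k = Nat.card {p // V p = v} := by
    intro k v hk
    rw [Acount_range φ hinj]
    apply Nat.card_congr
    apply Equiv.subtypeEquivRight
    intro p
    have e := hwt p
    constructor
    · intro h
      rw [h] at e
      linarith
    · intro h
      rw [h] at e
      have : (wt (φ p) : ℤ) = k := by linarith
      exact_mod_cast this
  rw [hsh]
  refine ⟨?_, ?_, ?_, ?_, ?_, ?_⟩
  · rw [Nat.card_eq_fintype_card, Fintype.card_subtype_compl, hK]
    simp
  · rw [LinearMap.finrank_range_of_inj hinj, Module.finrank_prod, hfK, hfL, add_comm]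
  · rw [hA _ (2 * M), c1]
    push_cast [Nat.cast_sub hle]
    ring
  · rw [hA _ 0, c2]
    push_cast
    ring
  · rw [hA _ (-(2 * M)), c3]
    push_cast
    ring
  · intro k k0 k1 k2 k3
    rw [Acount_range φ hinj]
    have : IsEmpty {p // wt (φ p) = k} := by
      constructor
      rintro ⟨p, hp⟩
      have e := hwt p
      rw [hp] at e
      by_cases hp0 : p = 0
      · subst hp0
        rw [map_zero] at hp
        apply k0
        rw [← hp]
        simp [wt]
      · rcases hVall p hp0 with h | h | h <;> rw [h] at e
        · apply k2
          zify
          linarith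
        · apply k1
          zify [hle]
          linarith
        · apply k3
          zify
          linarith
    exact Nat.card_of_isEmpty
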